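/- arXiv:2509.04979 — 3 statements merged into one kernel-verified Lean document; each statement's English description precedes it below -/
import Mathlib

section
/- Let P and P̃ be n×n row-stochastic matrices, α ∈ (0,1), and v ∈ ℝⁿ a probability vector. Let x⋆ and x̃⋆ be the unique probability vectors satisfying x⋆ = α Pᵀ x⋆ + (1−α) v and x̃⋆ = α P̃ᵀ x̃⋆ + (1−α) v. Then ‖x⋆ − x̃⋆‖₁ ≤ (α / (1−α)) · maxᵢ Σⱼ |Pᵢⱼ − P̃ᵢⱼ|. -/
open Matrix Finset

/-- Perturbation stability of the AgentRank fixed point: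
`‖x⋆ − x̃⋆‖₁ ≤ (α/(1−α)) · maxᵢ Σⱼ |Pᵢⱼ − P̃ᵢⱼ|`. -/
theorem teleport_fixed_point_perturbation_bound
    (n : ℕ) (P Ptil : Matrix (Fin n) (Fin n) ℝ)
    (hP0 : ∀ i j, 0 ≤ P i j) (hP1 : ∀ i, ∑ j, P i j = 1)
    (hPtil0 : ∀ i j, 0 ≤ Ptil i j) (hPtil1 : ∀ i, ∑ j, Ptil i j = 1)
    (α : ℝ) (hα : α ∈ Set.Ioo (0 : ℝ) 1)
    (v : Fin n → ℝ) (hv0 : ∀ i, 0 ≤ v i) (hv1 : ∑ i, v i = 1)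
    (xstar xtil : Fin n → ℝ)
    (hx0 : ∀ i, 0 ≤ xstar i) (hx1 : ∑ i, xstar i = 1)
    (hxt0 : ∀ i, 0 ≤ xtil i) (hxt1 : ∑ i, xtil i = 1)
    (hfix : xstar = α • Pᵀ.mulVec xstar + (1 - α) • v)
    (hfixt : xtil = α • Ptilᵀ.mulVec xtil + (1 - α) • v) :
    ∑ i, |xstar i - xtil i| ≤ (α / (1 - α)) * ⨆ i : Fin n, ∑ j, |P i j - Ptil i j| := by
  obtain ⟨ha0, ha1⟩ := hα
  set M := ⨆ i : Fin n, ∑ j, |P i j - Ptil i j| with hM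
  have hle : ∀ i, ∑ j, |P i j - Ptil i j| ≤ M := fun i =>
    le_ciSup (f := fun i : Fin n => ∑ j, |P i j - Ptil i j|) (Set.finite_range _).bddAbove i
  have hd : ∀ j, |xstar j - xtil j| ≤
      α * (∑ i, P i j * |xstar i - xtil i| + ∑ i, |P i j - Ptil i j| * xtil i) := by
    intro j
    have h1 : xstar j = α * (∑ i, P i j * xstar i) + (1 - α) * v j := by
      simpa [Matrix.mulVec, dotProduct] using congrFun hfix j
    have h2 : xtil j = α * (∑ i, Ptil i j * xtil i) + (1 - α) * v j := by
      simpa [Matrix.mulVec, dotProduct] using congrFun hfixt j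
    have h3 : xstar j - xtil j =
        α * (∑ i, P i j * (xstar i - xtil i) + ∑ i, (P i j - Ptil i j) * xtil i) := by
      simp only [mul_sub, sub_mul, Finset.sum_sub_distrib]
      linarith
    rw [h3, abs_mul, abs_of_pos ha0]
    refine mul_le_mul_of_nonneg_left ((abs_add_le _ _).trans (add_le_add ?_ ?_)) ha0.le
    · refine (Finset.abs_sum_le_sum_abs _ _).trans (Finset.sum_le_sum fun i _ => ?_)
      rw [abs_mul, abs_of_nonneg (hP0 i j)]
    · refine (Finset.abs_sum_le_sum_abs _ _).trans (Finset.sum_le_sum fun i _ => ?_)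
      rw [abs_mul, abs_of_nonneg (hxt0 i)]
  have hS := Finset.sum_le_sum fun j (_ : j ∈ Finset.univ) => hd j
  rw [← Finset.mul_sum, Finset.sum_add_distrib, Finset.sum_comm,
    Finset.sum_comm (f := fun j i => |P i j - Ptil i j| * xtil i)] at hS
  simp only [← Finset.sum_mul, hP1, one_mul] at hS
  have hT : ∑ i, (∑ j, |P i j - Ptil i j|) * xtil i ≤ M := by
    calc _ ≤ ∑ i, M * xtil i :=
          Finset.sum_le_sum fun i _ => mul_le_mul_of_nonneg_right (hle i) (hxt0 i)
      _ = M := by rw [← Finset.mul_sum, hxt1, mul_one]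
  have hT2 := mul_le_mul_of_nonneg_left hT ha0.le
  rw [div_mul_eq_mul_div, le_div_iff₀ (by linarith)]
  linarith
end

section
/- Let P be an n×n row-stochastic matrix, α ∈ (0,1), v ∈ ℝⁿ a probability vector, and x⋆ the unique probability vector satisfying x⋆ = α Pᵀ x⋆ + (1−α) v. Then for every subset S of the index set {1,…,n}, writing x_S := Σ_{j∈S} x⋆ⱼ and v_S := Σ_{j∈S} vⱼ, one has the sandwich bound (1−α) v_S ≤ x_S ≤ α + (1−α) v_S. -/
open Matrix Finset

/-- Usage-only Sybil amplification bound (sandwich bound): for any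
subset `S` of agents, `(1−α) v_S ≤ x_S ≤ α + (1−α) v_S`. -/
theorem sybil_usage_sandwich_bound
    (n : ℕ) (P : Matrix (Fin n) (Fin n) ℝ)
    (hP0 : ∀ i j, 0 ≤ P i j) (hP1 : ∀ i, ∑ j, P i j = 1)
    (α : ℝ) (hα : α ∈ Set.Ioo (0 : ℝ) 1)
    (v : Fin n → ℝ) (hv0 : ∀ i, 0 ≤ v i) (hv1 : ∑ i, v i = 1)
    (xstar : Fin n → ℝ) (hx0 : ∀ i, 0 ≤ xstar i) (hx1 : ∑ i, xstar i = 1)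
    (hfix : xstar = α • Pᵀ.mulVec xstar + (1 - α) • v)
    (S : Finset (Fin n)) :
    (1 - α) * ∑ j ∈ S, v j ≤ ∑ j ∈ S, xstar j ∧
    ∑ j ∈ S, xstar j ≤ α + (1 - α) * ∑ j ∈ S, v j := by
  obtain ⟨h0, h1⟩ := hα
  have hy0 : ∀ j, 0 ≤ (Pᵀ.mulVec xstar) j := by
    intro j
    simp only [Matrix.mulVec, dotProduct, Matrix.transpose_apply]
    exact Finset.sum_nonneg fun i _ => mul_nonneg (hP0 i j) (hx0 i)
  have hy1 : ∑ j, (Pᵀ.mulVec xstar) j = 1 := by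
    simp only [Matrix.mulVec, dotProduct, Matrix.transpose_apply]
    rw [Finset.sum_comm]
    simp only [← Finset.sum_mul, hP1, one_mul, hx1]
  have hS0 : 0 ≤ ∑ j ∈ S, (Pᵀ.mulVec xstar) j := Finset.sum_nonneg fun j _ => hy0 j
  have hS1 : ∑ j ∈ S, (Pᵀ.mulVec xstar) j ≤ 1 := by
    rw [← hy1]
    exact Finset.sum_le_sum_of_subset_of_nonneg (Finset.subset_univ S) fun j _ _ => hy0 j
  have hx : ∑ j ∈ S, xstar j
      = α * ∑ j ∈ S, (Pᵀ.mulVec xstar) j + (1 - α) * ∑ j ∈ S, v j := by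
    rw [Finset.mul_sum, Finset.mul_sum, ← Finset.sum_add_distrib]
    exact Finset.sum_congr rfl fun j _ => congrFun hfix j
  rw [hx]
  constructor <;> nlinarith
end

section
/- Let x, y ∈ ℝⁿ be probability vectors with all coordinates strictly positive, let p ∈ (0,1], let α ∈ (0,1), and let v ∈ ℝⁿ be a probability vector with all entries strictly positive. Let S be a subset of the index set, write x_S := Σ_{j∈S} xⱼ, y_S := Σ_{j∈S} yⱼ, v_S := Σ_{j∈S} vⱼ, and v_min := min_{j∉S} vⱼ. Assume x_S ≤ α + (1−α) v_S, xⱼ ≥ (1−α) vⱼ for all j, and y_S < 1. Define the fused score rⱼ = xⱼᵖ yⱼ^{1−p} / Σᵢ xᵢᵖ yᵢ^{1−p} and r_S := Σ_{j∈S} rⱼ. Then r_S ≤ ( (α + (1−α)v_S)ᵖ y_S^{1−p} ) / ( (α + (1−α)v_S)ᵖ y_S^{1−p} + (1−α)ᵖ v_minᵖ (1 − y_S)^{1−p} ), and in particular r_S < 1. -/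
open Finset

lemma holder_aux {n : ℕ} (x y : Fin n → ℝ) (hx0 : ∀ j, 0 < x j) (hy0 : ∀ j, 0 < y j)
    (p : ℝ) (hp0 : 0 < p) (hp1 : p ≤ 1) (S : Finset (Fin n)) :
    ∑ j ∈ S, x j ^ p * y j ^ (1 - p) ≤ (∑ j ∈ S, x j) ^ p * (∑ j ∈ S, y j) ^ (1 - p) := by
  rcases S.eq_empty_or_nonempty with rfl | hS
  · simp [Real.zero_rpow hp0.ne']
  have hX : 0 < ∑ j ∈ S, x j := Finset.sum_pos (fun j _ => hx0 j) hS
  have hY : 0 < ∑ j ∈ S, y j := Finset.sum_pos (fun j _ => hy0 j) hS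
  set X := ∑ j ∈ S, x j with hXd
  set Y := ∑ j ∈ S, y j with hYd
  have hXp : 0 < X ^ p := Real.rpow_pos_of_pos hX _
  have hYp : 0 < Y ^ (1 - p) := Real.rpow_pos_of_pos hY _
  have key : ∀ j ∈ S, x j ^ p * y j ^ (1 - p) ≤
      (X ^ p * Y ^ (1 - p)) * (p * (x j / X) + (1 - p) * (y j / Y)) := by
    intro j _
    have h := Real.geom_mean_le_arith_mean2_weighted hp0.le (sub_nonneg.2 hp1)
      (div_pos (hx0 j) hX).le (div_pos (hy0 j) hY).le (by ring)
    rw [Real.div_rpow (hx0 j).le hX.le, Real.div_rpow (hy0 j).le hY.le] at h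
    calc x j ^ p * y j ^ (1 - p)
        = (X ^ p * Y ^ (1 - p)) * (x j ^ p / X ^ p * (y j ^ (1 - p) / Y ^ (1 - p))) := by
          field_simp
      _ ≤ _ := mul_le_mul_of_nonneg_left h (by positivity)
  refine (Finset.sum_le_sum key).trans (le_of_eq ?_)
  rw [← Finset.mul_sum, Finset.sum_add_distrib, ← Finset.mul_sum, ← Finset.mul_sum,
    ← Finset.sum_div, ← Finset.sum_div, ← hXd, ← hYd, div_self hX.ne', div_self hY.ne']
  ring

lemma subadd_aux {n : ℕ} (y : Fin n → ℝ) (hy0 : ∀ j, 0 < y j)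
    (p : ℝ) (hp0 : 0 < p) (T : Finset (Fin n)) (hT : T.Nonempty) :
    (∑ j ∈ T, y j) ^ (1 - p) ≤ ∑ j ∈ T, y j ^ (1 - p) := by
  have hY : 0 < ∑ j ∈ T, y j := Finset.sum_pos (fun j _ => hy0 j) hT
  have e : ∀ t : ℝ, 0 < t → t ^ (1 - p) = t * t ^ (-p) := by
    intro t ht
    rw [sub_eq_add_neg, Real.rpow_add ht, Real.rpow_one]
  rw [e _ hY, Finset.sum_mul]
  refine Finset.sum_le_sum fun j hj => ?_
  rw [e _ (hy0 j)]
  refine mul_le_mul_of_nonneg_left ?_ (hy0 j).le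
  exact Real.rpow_le_rpow_of_nonpos (hy0 j)
    (Finset.single_le_sum (fun i _ => (hy0 i).le) hj) (by linarith)

/-- Sybil non-amplification (Part B). Under the teleportation usage cap
`x_S ≤ α + (1−α) v_S`, the teleportation floor `xⱼ ≥ (1−α) vⱼ`, and a clique
competence share `y_S < 1`, the fused rank mass of the clique satisfies
`r_S ≤ (α+(1−α)v_S)ᵖ y_S^{1−p} / ((α+(1−α)v_S)ᵖ y_S^{1−p} + (1−α)ᵖ v_minᵖ (1−y_S)^{1−p})`,
and in particular `r_S < 1`. -/
theorem sybil_non_amplification_fused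
    (n : ℕ) (x y : Fin n → ℝ)
    (hx0 : ∀ j, 0 < x j) (hx1 : ∑ j, x j = 1)
    (hy0 : ∀ j, 0 < y j) (hy1 : ∑ j, y j = 1)
    (p : ℝ) (hp : p ∈ Set.Ioc (0 : ℝ) 1)
    (α : ℝ) (hα : α ∈ Set.Ioo (0 : ℝ) 1)
    (v : Fin n → ℝ) (hv0 : ∀ j, 0 < v j) (hv1 : ∑ j, v j = 1)
    (S : Finset (Fin n)) (hSc : Sᶜ.Nonempty)
    (hcap : ∑ j ∈ S, x j ≤ α + (1 - α) * ∑ j ∈ S, v j)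
    (hfloor : ∀ j, (1 - α) * v j ≤ x j)
    (hyS : ∑ j ∈ S, y j < 1) :
    (∑ j ∈ S, (x j ^ p * y j ^ (1 - p)) / ∑ i, x i ^ p * y i ^ (1 - p))
      ≤ ((α + (1 - α) * ∑ j ∈ S, v j) ^ p * (∑ j ∈ S, y j) ^ (1 - p)) /
        ((α + (1 - α) * ∑ j ∈ S, v j) ^ p * (∑ j ∈ S, y j) ^ (1 - p)
          + (1 - α) ^ p * (Sᶜ.inf' hSc v) ^ p * (1 - ∑ j ∈ S, y j) ^ (1 - p)) ∧
    (∑ j ∈ S, (x j ^ p * y j ^ (1 - p)) / ∑ i, x i ^ p * y i ^ (1 - p)) < 1 := by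
  obtain ⟨hp0, hp1⟩ := hp
  obtain ⟨hα0, hα1⟩ := hα
  have hα' : 0 < 1 - α := by linarith
  have hYc : ∑ j ∈ Sᶜ, y j = 1 - ∑ j ∈ S, y j := by
    have := Finset.sum_add_sum_compl S y
    linarith
  have hm : 0 < Sᶜ.inf' hSc v := by
    rw [Finset.lt_inf'_iff]
    exact fun j _ => hv0 j
  have hA0 : 0 ≤ ∑ j ∈ S, x j ^ p * y j ^ (1 - p) := Finset.sum_nonneg fun j _ =>
    mul_nonneg (Real.rpow_nonneg (hx0 j).le _) (Real.rpow_nonneg (hy0 j).le _)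
  have hA : ∑ j ∈ S, x j ^ p * y j ^ (1 - p) ≤
      (α + (1 - α) * ∑ j ∈ S, v j) ^ p * (∑ j ∈ S, y j) ^ (1 - p) := by
    refine (holder_aux x y hx0 hy0 p hp0 hp1 S).trans ?_
    refine mul_le_mul_of_nonneg_right ?_
      (Real.rpow_nonneg (Finset.sum_nonneg fun j _ => (hy0 j).le) _)
    exact Real.rpow_le_rpow (Finset.sum_nonneg fun j _ => (hx0 j).le) hcap hp0.le
  have hM : 0 < (1 - α) ^ p * (Sᶜ.inf' hSc v) ^ p * (1 - ∑ j ∈ S, y j) ^ (1 - p) :=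
    mul_pos (mul_pos (Real.rpow_pos_of_pos hα' _) (Real.rpow_pos_of_pos hm _))
      (Real.rpow_pos_of_pos (by linarith) _)
  have hB : (1 - α) ^ p * (Sᶜ.inf' hSc v) ^ p * (1 - ∑ j ∈ S, y j) ^ (1 - p) ≤
      ∑ j ∈ Sᶜ, x j ^ p * y j ^ (1 - p) := by
    rw [← hYc, ← Real.mul_rpow hα'.le hm.le]
    refine (mul_le_mul_of_nonneg_left (subadd_aux y hy0 p hp0 Sᶜ hSc)
      (Real.rpow_nonneg (mul_pos hα' hm).le _)).trans ?_
    rw [Finset.mul_sum]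
    refine Finset.sum_le_sum fun j hj => ?_
    refine mul_le_mul_of_nonneg_right ?_ (Real.rpow_nonneg (hy0 j).le _)
    refine Real.rpow_le_rpow (mul_pos hα' hm).le ?_ hp0.le
    exact (mul_le_mul_of_nonneg_left (Finset.inf'_le v hj) hα'.le).trans (hfloor j)
  rw [← Finset.sum_div, ← Finset.sum_add_sum_compl S (fun i => x i ^ p * y i ^ (1 - p))]
  generalize (1 - α) ^ p * (Sᶜ.inf' hSc v) ^ p * (1 - ∑ j ∈ S, y j) ^ (1 - p) = M at *
  generalize (α + (1 - α) * ∑ j ∈ S, v j) ^ p * (∑ j ∈ S, y j) ^ (1 - p) = N at *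
  generalize ∑ j ∈ S, x j ^ p * y j ^ (1 - p) = A at *
  generalize ∑ j ∈ Sᶜ, x j ^ p * y j ^ (1 - p) = B at *
  constructor
  · rw [div_le_div_iff₀ (by linarith) (by linarith)]
    have := mul_le_mul hA hB hM.le (hA0.trans hA)
    linarith
  · rw [div_lt_one (by linarith)]
    linarith
end
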